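/- Let X be a Ptolemy space with properties (E) and (I), ω ∈ X, and let l, l' be Ptolemy lines in X_ω with a common point o. Let c, c' : ℝ → X_ω be unit-speed parameterizations of l and l' with c(0) = o = c'(0), and set b(x) = lim_{t→∞}(d(x,c(t)) − t). If b(c'(t)) = −t for all t ≥ 0, then l = l'. In particular, two Ptolemy lines in X_ω that share their Busemann functions coincide as soon as they have a common point. -/

import Mathlib

open scoped ENNReal

namespace Mobius

/-- An extended metric on `X`, allowed to have (at most) one infinitely remote point,
which is recorded in the field `rem`.  Distances take values in `ℝ≥0∞`, and the value `⊤`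
occurs exactly on pairs of distinct points one of which is the remote point. -/
structure ExtMetric (X : Type*) where
  d : X → X → ℝ≥0∞
  rem : Option X
  symm : ∀ x y, d x y = d y x
  d_self : ∀ x, d x x = 0
  pos : ∀ x y, x ≠ y → 0 < d x y
  triangle : ∀ x y z, d x z ≤ d x y + d y z
  d_eq_top_iff : ∀ x y, d x y = ⊤ ↔ (x ≠ y ∧ (rem = some x ∨ rem = some y))

/-- The finite factor of a distance used in cross-ratio triples: infinite factors are
dropped (replaced by `1`), in accordance with the standard conventions for cross-ratio
triples of quadruples containing the infinitely remote point. -/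
noncomputable def ExtMetric.fd {X : Type*} (d : ExtMetric X) (x y : X) : ℝ :=
  if d.d x y = ⊤ then 1 else (d.d x y).toReal

/-- A representative in `ℝ³` of the cross-ratio triple
`crt(x,y,z,u) = (d(x,y)d(z,u) : d(x,z)d(y,u) : d(x,u)d(y,z)) ∈ ℝP²`,
with the standard conventions when the infinitely remote point occurs among the points. -/
noncomputable def crtVec {X : Type*} (d : ExtMetric X) (x y z u : X) : ℝ × ℝ × ℝ :=
  (d.fd x y * d.fd z u, d.fd x z * d.fd y u, d.fd x u * d.fd y z)

/-- A quadruple is admissible if no entry occurs three or four times in it. -/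
def Admissible {X : Type*} (x y z u : X) : Prop :=
  ¬(x = y ∧ y = z) ∧ ¬(x = y ∧ y = u) ∧ ¬(x = z ∧ z = u) ∧ ¬(y = z ∧ z = u)

/-- Two vectors in `ℝ³` represent the same point of the projective plane (they are
positively proportional). -/
def ProjEq (v w : ℝ × ℝ × ℝ) : Prop :=
  ∃ lam : ℝ, 0 < lam ∧ w = lam • v

theorem ProjEq.refl (v : ℝ × ℝ × ℝ) : ProjEq v v :=
  ⟨1, one_pos, (one_smul ℝ v).symm⟩

theorem ProjEq.symm {v w : ℝ × ℝ × ℝ} (h : ProjEq v w) : ProjEq w v := by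
  obtain ⟨l, hl, rfl⟩ := h
  exact ⟨l⁻¹, inv_pos.mpr hl, by rw [smul_smul, inv_mul_cancel₀ hl.ne', one_smul]⟩

theorem ProjEq.trans' {v w u : ℝ × ℝ × ℝ} (h1 : ProjEq v w) (h2 : ProjEq v u) :
    ProjEq w u := by
  obtain ⟨l, hl, rfl⟩ := h1
  obtain ⟨m, hm, rfl⟩ := h2
  refine ⟨m * l⁻¹, by positivity, ?_⟩
  rw [smul_smul, mul_assoc, inv_mul_cancel₀ hl.ne', mul_one]

/-- A Möbius structure on a set `X`: a (maximal) class of pairwise Möbius-equivalent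
extended metrics on `X`, i.e. metrics defining the same cross-ratio triples on all
admissible quadruples. -/
structure MobiusStructure (X : Type*) where
  M : Set (ExtMetric X)
  nonempty : M.Nonempty
  compat : ∀ d ∈ M, ∀ d' ∈ M, ∀ x y z u : X, Admissible x y z u →
    ProjEq (crtVec d x y z u) (crtVec d' x y z u)
  maximal : ∀ d' : ExtMetric X,
    (∀ d ∈ M, ∀ x y z u : X, Admissible x y z u →
      ProjEq (crtVec d x y z u) (crtVec d' x y z u)) → d' ∈ M

/-- The Möbius structure generated by a single extended metric. -/
def MobiusStructure.ofMetric {X : Type*} (d₀ : ExtMetric X) : MobiusStructure X where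
  M := {d | ∀ x y z u : X, Admissible x y z u →
    ProjEq (crtVec d₀ x y z u) (crtVec d x y z u)}
  nonempty := ⟨d₀, fun _ _ _ _ _ => ProjEq.refl _⟩
  compat := fun _ hd _ hd' x y z u ha => (hd x y z u ha).trans' (hd' x y z u ha)
  maximal := fun _ h => h d₀ (fun _ _ _ _ _ => ProjEq.refl _)

/-- A Möbius structure is Ptolemy if the entries of every cross-ratio triple of every
admissible quadruple satisfy the triangle inequality. -/
def IsPtolemyStructure {X : Type*} (S : MobiusStructure X) : Prop :=
  ∀ d ∈ S.M, ∀ x y z u : X, Admissible x y z u →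
    (crtVec d x y z u).1 ≤ (crtVec d x y z u).2.1 + (crtVec d x y z u).2.2 ∧
    (crtVec d x y z u).2.1 ≤ (crtVec d x y z u).1 + (crtVec d x y z u).2.2 ∧
    (crtVec d x y z u).2.2 ≤ (crtVec d x y z u).1 + (crtVec d x y z u).2.1

/-- The topology of a Möbius space: generated by the open balls of the metrics of the
structure (centered at points distinct from the respective remote points) together with
the complements of the closed balls. -/
def mobiusTop {X : Type*} (S : MobiusStructure X) : TopologicalSpace X :=
  TopologicalSpace.generateFrom
    {s | ∃ d ∈ S.M, ∃ x : X, d.rem ≠ some x ∧ ∃ r : ℝ≥0∞, 0 < r ∧ r ≠ ⊤ ∧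
      (s = {y | d.d y x < r} ∨ s = {y | r < d.d y x})}

/-- Connected components of subsets with respect to the Möbius topology. -/
def mobiusCCIn {X : Type*} (S : MobiusStructure X) (F : Set X) (x : X) : Set X :=
  @connectedComponentIn X (mobiusTop S) F x

/-- The pair `(x,z)` separates the pair `(y,u)` in `σ`:  `y` and `u` lie in different
connected components of `σ \ {x,z}`. -/
def SeparatesIn {X : Type*} (S : MobiusStructure X) (σ : Set X) (x z y u : X) : Prop :=
  u ∉ mobiusCCIn S (σ \ {x, z}) y

/-- `σ` is homeomorphic to the circle `S¹` (with respect to the Möbius topology). -/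
def HomeoToCircle {X : Type*} (S : MobiusStructure X) (σ : Set X) : Prop :=
  letI : TopologicalSpace X := mobiusTop S
  Nonempty (σ ≃ₜ Metric.sphere (0 : ℂ) 1)

/-- `X` is homeomorphic to the sphere `Sⁿ ⊆ ℝ^{n+1}` (w.r.t. the Möbius topology). -/
def HomeoToSphere {X : Type*} (S : MobiusStructure X) (n : ℕ) : Prop :=
  letI : TopologicalSpace X := mobiusTop S
  Nonempty (X ≃ₜ Metric.sphere (0 : EuclideanSpace ℝ (Fin (n + 1))) 1)

/-- The subset `A ⊆ X` is homeomorphic to `ℝᵖ` (w.r.t. the Möbius topology). -/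
def SubsetHomeoToEuclidean {X : Type*} (S : MobiusStructure X) (A : Set X) (p : ℕ) : Prop :=
  letI : TopologicalSpace X := mobiusTop S
  Nonempty (A ≃ₜ EuclideanSpace ℝ (Fin p))

/-- The subset `A ⊆ X` is homeomorphic to `ℝ` (w.r.t. the Möbius topology). -/
def SubsetHomeoToReal {X : Type*} (S : MobiusStructure X) (A : Set X) : Prop :=
  letI : TopologicalSpace X := mobiusTop S
  Nonempty (A ≃ₜ ℝ)

/-- A Ptolemy circle: a subset homeomorphic to `S¹` on which the Ptolemy equality holds
for every quadruple of distinct points `(x,y,z,u)` such that `(x,z)` separates `(y,u)`. -/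
def IsPtolemyCircle {X : Type*} (S : MobiusStructure X) (σ : Set X) : Prop :=
  HomeoToCircle S σ ∧
  ∀ d ∈ S.M, ∀ x ∈ σ, ∀ y ∈ σ, ∀ z ∈ σ, ∀ u ∈ σ,
    x ≠ y → x ≠ z → x ≠ u → y ≠ z → y ≠ u → z ≠ u →
    SeparatesIn S σ x z y u →
    d.d x z * d.d y u = d.d x y * d.d z u + d.d x u * d.d y z

/-- A Möbius automorphism of `X`: a bijection preserving all cross-ratio triples. -/
def IsMobiusAuto {X : Type*} (S : MobiusStructure X) (f : X → X) : Prop :=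
  Function.Bijective f ∧ ∀ d ∈ S.M, ∀ x y z u : X, Admissible x y z u →
    ProjEq (crtVec d x y z u) (crtVec d (f x) (f y) (f z) (f u))

/-- A metric sphere between two distinct points `ω`, `ω'`. -/
def IsMetricSphere {X : Type*} (S : MobiusStructure X) (ω ω' : X) (Sp : Set X) : Prop :=
  ∃ d ∈ S.M, d.rem = some ω' ∧ ∃ r : ℝ≥0∞, 0 < r ∧ r ≠ ⊤ ∧ Sp = {x | d.d x ω = r}

/-- A space inversion with respect to `ω`, `ω'` and a metric sphere `Sp` between them. -/
def IsSpaceInversion {X : Type*} (S : MobiusStructure X) (ω ω' : X) (Sp : Set X)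
    (φ : X → X) : Prop :=
  IsMobiusAuto S φ ∧ Function.Involutive φ ∧ (∀ x, φ x ≠ x) ∧ φ ω = ω' ∧
  φ '' Sp = Sp ∧ ∀ σ : Set X, IsPtolemyCircle S σ → ω ∈ σ → ω' ∈ σ → φ '' σ = σ

/-- Property (E): existence of at least one Ptolemy circle. -/
def PropertyE {X : Type*} (S : MobiusStructure X) : Prop :=
  ∃ σ : Set X, IsPtolemyCircle S σ

/-- Property (I): existence and uniqueness of space inversions. -/
def PropertyI {X : Type*} (S : MobiusStructure X) : Prop :=
  ∀ ω ω' : X, ω ≠ ω' → ∀ Sp : Set X, IsMetricSphere S ω ω' Sp →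
    ∃! φ : X → X, IsSpaceInversion S ω ω' Sp φ

/-- The Möbius space is compact. -/
def MobiusCompact {X : Type*} (S : MobiusStructure X) : Prop :=
  letI : TopologicalSpace X := mobiusTop S
  CompactSpace X

/-- Property (H), the homothety property. -/
def PropertyH {X : Type*} (S : MobiusStructure X) : Prop :=
  ∀ ω ω' : X, ω ≠ ω' → ∀ σ : Set X, IsPtolemyCircle S σ → ω ∈ σ → ω' ∈ σ →
    ∀ x x' : X, x ∈ σ \ {ω, ω'} → x' ∈ mobiusCCIn S (σ \ {ω, ω'}) x →
    ∃ γ : X → X, IsMobiusAuto S γ ∧ γ ω = ω ∧ γ ω' = ω' ∧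
      (∀ σ' : Set X, IsPtolemyCircle S σ' → ω ∈ σ' → ω' ∈ σ' →
        γ '' σ' = σ' ∧ ∀ y ∈ σ' \ {ω, ω'}, γ y ∈ mobiusCCIn S (σ' \ {ω, ω'}) y) ∧
      γ x = x'

/-- A Ptolemy line in `X_ω`: a Ptolemy circle through `ω` with `ω` removed. -/
def IsPtolemyLine {X : Type*} (S : MobiusStructure X) (ω : X) (l : Set X) : Prop :=
  ∃ σ : Set X, IsPtolemyCircle S σ ∧ ω ∈ σ ∧ l = σ \ {ω}

/-- `c : ℝ → X` is a unit-speed parameterization of `l ⊆ X` w.r.t. the metric `d`. -/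
def IsUnitSpeed {X : Type*} (d : ExtMetric X) (l : Set X) (c : ℝ → X) : Prop :=
  Set.range c = l ∧ ∀ s t : ℝ, d.d (c s) (c t) = ENNReal.ofReal |s - t|

/-- `b` is a Busemann function of the Ptolemy line `l ⊆ X_ω`:  up to an additive constant,
`b x = lim_{t→∞} (d(x,c(t)) − t)` for a unit-speed parameterization `c` of `l`. -/
def IsBusemannOf {X : Type*} (S : MobiusStructure X) (d : ExtMetric X) (ω : X)
    (l : Set X) (b : X → ℝ) : Prop :=
  IsPtolemyLine S ω l ∧ ∃ c : ℝ → X, IsUnitSpeed d l c ∧ ∃ C : ℝ, ∀ x : X, x ≠ ω →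
    Filter.Tendsto (fun t => (d.d x (c t)).toReal - t) Filter.atTop (nhds (b x + C))

/-- The fiber through `x` of the canonical fibration `π_ω`: the set of points on which
every Busemann function of every Ptolemy line of `X_ω` takes the same value as at `x`. -/
def mobiusFiber {X : Type*} (S : MobiusStructure X) (d : ExtMetric X) (ω : X) (x : X) :
    Set X :=
  {y | y ≠ ω ∧ ∀ (l : Set X) (b : X → ℝ), IsBusemannOf S d ω l b → b y = b x}

/-- The base `B_ω` of the canonical fibration: the set of all fibers. -/
def mobiusBase {X : Type*} (S : MobiusStructure X) (d : ExtMetric X) (ω : X) :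
    Set (Set X) :=
  {F | ∃ x : X, x ≠ ω ∧ F = mobiusFiber S d ω x}

/-- The distance between two fibers. -/
noncomputable def fiberDist {X : Type*} (d : ExtMetric X) (F F' : Set X) : ℝ :=
  sInf {r : ℝ | ∃ x ∈ F, ∃ x' ∈ F', r = (d.d x x').toReal}

/-- Two Möbius spaces are Möbius equivalent: there is a bijection between them
preserving all cross-ratio triples. -/
def MobiusEquiv {X Y : Type*} (S : MobiusStructure X) (S' : MobiusStructure Y) : Prop :=
  ∃ f : X → Y, Function.Bijective f ∧ ∀ d ∈ S.M, ∀ d' ∈ S'.M, ∀ x y z u : X,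
    Admissible x y z u → ProjEq (crtVec d x y z u) (crtVec d' (f x) (f y) (f z) (f u))

/-- The standard extended Euclidean metric on the one-point extension
`ℝ̂ⁿ = ℝⁿ ∪ {∞}`, where `∞` is encoded by `none`. -/
noncomputable def stdExtMetric (n : ℕ) : ExtMetric (Option (EuclideanSpace ℝ (Fin n))) where
  d x y :=
    match x, y with
    | none, none => 0
    | none, some _ => ⊤
    | some _, none => ⊤
    | some a, some b => ENNReal.ofReal (dist a b)
  rem := some none
  symm := by intro x y; cases x <;> cases y <;> simp [dist_comm]
  d_self := by intro x; cases x <;> simp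
  pos := by
    intro x y h
    cases x <;> cases y
    · exact absurd rfl h
    · simp
    · simp
    · simp only [ne_eq, Option.some.injEq] at h
      exact ENNReal.ofReal_pos.mpr (dist_pos.mpr h)
  triangle := by
    intro x y z
    cases x <;> cases y <;> cases z <;>
      simp only [le_refl, le_top, zero_le, zero_add, add_zero, top_add, add_top,
        top_le_iff]
    rw [← ENNReal.ofReal_add dist_nonneg dist_nonneg]
    exact ENNReal.ofReal_le_ofReal (dist_triangle _ _ _)
  d_eq_top_iff := by
    intro x y
    cases x <;> cases y <;>
      simp [ENNReal.ofReal_ne_top]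

namespace ExtMetric

variable {X : Type*} (d : ExtMetric X)

theorem fd_symm (x y : X) : d.fd x y = d.fd y x := by
  simp only [fd, d.symm x y]

theorem fd_self (x : X) : d.fd x x = 0 := by
  simp [fd, d.d_self]

theorem fd_pos {x y : X} (h : x ≠ y) : 0 < d.fd x y := by
  unfold fd
  split_ifs with ht
  · exact one_pos
  · exact ENNReal.toReal_pos (d.pos x y h).ne' ht

theorem fd_nonneg (x y : X) : 0 ≤ d.fd x y := by
  rcases eq_or_ne x y with rfl | h
  · exact (d.fd_self x).ge
  · exact (d.fd_pos h).le

variable {d}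

theorem d_ne_top {x y : X} (hx : d.rem ≠ some x) (hy : d.rem ≠ some y) : d.d x y ≠ ⊤ :=
  fun h => ((d.d_eq_top_iff x y).1 h).2.elim hx hy

theorem fd_eq_toReal {x y : X} (hx : d.rem ≠ some x) (hy : d.rem ≠ some y) :
    d.fd x y = (d.d x y).toReal :=
  if_neg (d_ne_top hx hy)

theorem ofReal_fd {x y : X} (hx : d.rem ≠ some x) (hy : d.rem ≠ some y) :
    ENNReal.ofReal (d.fd x y) = d.d x y := by
  rw [fd_eq_toReal hx hy, ENNReal.ofReal_toReal (d_ne_top hx hy)]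

theorem d_rem {w x : X} (h : d.rem = some w) (hx : x ≠ w) : d.d x w = ⊤ :=
  (d.d_eq_top_iff x w).2 ⟨hx, Or.inr h⟩

theorem fd_rem {w x : X} (h : d.rem = some w) (hx : x ≠ w) : d.fd x w = 1 :=
  if_pos (d_rem h hx)

theorem fd_rem' {w x : X} (h : d.rem = some w) (hx : x ≠ w) : d.fd w x = 1 := by
  rw [fd_symm, fd_rem h hx]

theorem fd_triangle {x y z : X} (hx : d.rem ≠ some x) (hy : d.rem ≠ some y)
    (hz : d.rem ≠ some z) : d.fd x z ≤ d.fd x y + d.fd y z := by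
  rw [fd_eq_toReal hx hz, fd_eq_toReal hx hy, fd_eq_toReal hy hz,
    ← ENNReal.toReal_add (d_ne_top hx hy) (d_ne_top hy hz)]
  exact ENNReal.toReal_mono (ENNReal.add_ne_top.2 ⟨d_ne_top hx hy, d_ne_top hy hz⟩)
    (d.triangle x y z)

end ExtMetric

/-- `φ` is an inversion of `X_ω` centered at `p`, of squared radius `R`. -/
structure IsInversionAt {X : Type*} (S : MobiusStructure X) (d : ExtMetric X) (ω p : X)
    (R : ℝ) (φ : X → X) : Prop where
  pos : 0 < R
  invol : Function.Involutive φ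
  ne_self : ∀ x, φ x ≠ x
  map_center : φ p = ω
  fd_center : ∀ x, x ≠ ω → x ≠ p → d.fd (φ x) p * d.fd x p = R
  fd_map : ∀ x y, x ≠ ω → x ≠ p → y ≠ ω → y ≠ p →
    d.fd (φ x) (φ y) * (d.fd x p * d.fd y p) = R * d.fd x y
  image_circle : ∀ σ : Set X, IsPtolemyCircle S σ → ω ∈ σ → p ∈ σ → φ '' σ = σ

theorem exists_isInversionAt {X : Type*} {S : MobiusStructure X} (hI : PropertyI S)
    {ω : X} {d : ExtMetric X} (hd : d ∈ S.M) (hrem : d.rem = some ω) {p x₀ : X}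
    (hp : p ≠ ω) (hx₀ : x₀ ≠ ω) (hx₀p : x₀ ≠ p) :
    ∃ (R : ℝ) (φ : X → X), IsInversionAt S d ω p R φ := by
  obtain ⟨φ, ⟨⟨-, hcr⟩, hinv, hfix, hmap, -, hσ⟩, -⟩ := hI p ω hp {x | d.d x p = 1}
    ⟨d, hd, hrem, 1, one_pos, ENNReal.one_ne_top, rfl⟩
  have hmap' : φ ω = p := by rw [← hmap, hinv]
  have hω : ∀ x, x ≠ p → φ x ≠ ω := fun x hx h => hx (by rw [← hinv x, h, hmap'])
  have hpp : ∀ x, x ≠ ω → φ x ≠ p := fun x hx h => hx (by rw [← hinv x, h, hmap])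
  have key : ∀ x y, x ≠ ω → x ≠ p → y ≠ ω → y ≠ p → ∃ lam : ℝ, 0 < lam ∧
      d.fd (φ x) (φ y) = lam * d.fd x y ∧ d.fd (φ x) p = lam * d.fd y p ∧
      d.fd (φ y) p = lam * d.fd x p := by
    intro x y hx hxp hy hyp
    obtain ⟨lam, hl, h⟩ := hcr d hd x y ω p
      ⟨fun h => hy h.2, fun h => hyp h.2, fun h => hx h.1, fun h => hy h.1⟩
    simp only [crtVec, hmap, hmap', Prod.smul_mk, smul_eq_mul, Prod.mk.injEq,
      ExtMetric.fd_rem hrem hx, ExtMetric.fd_rem hrem hy, ExtMetric.fd_rem hrem (hω x hxp),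
      ExtMetric.fd_rem hrem (hω y hyp), ExtMetric.fd_rem hrem hp, ExtMetric.fd_rem' hrem hp,
      mul_one, one_mul] at h
    exact ⟨lam, hl, h⟩
  refine ⟨d.fd (φ x₀) p * d.fd x₀ p, φ, mul_pos (d.fd_pos (hpp _ hx₀)) (d.fd_pos hx₀p),
    hinv, hfix, hmap, ?_, ?_, fun σ h1 h2 h3 => hσ σ h1 h3 h2⟩
  · intro x hx hxp
    obtain ⟨lam, -, -, h1, h2⟩ := key x x₀ hx hxp hx₀ hx₀p
    rw [h1, h2]; ring
  · intro x y hx hxp hy hyp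
    obtain ⟨lam, -, h0, h1, -⟩ := key x y hx hxp hy hyp
    obtain ⟨mu, -, -, h2, h3⟩ := key x x₀ hx hxp hx₀ hx₀p
    rw [h0, h3, show mu * d.fd x p * d.fd x₀ p = (mu * d.fd x₀ p) * d.fd x p by ring, ← h2, h1]
    ring

/-- A distance-preserving curve in `X_ω` avoids `ω`. -/
theorem ne_of_dist {X : Type*} {ω : X} {d : ExtMetric X} (hrem : d.rem = some ω)
    {c : ℝ → X} (hc : ∀ s t : ℝ, d.d (c s) (c t) = ENNReal.ofReal |s - t|) (t : ℝ) :
    c t ≠ ω := by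
  intro h
  by_cases h1 : c (t + 1) = ω
  · have := hc t (t + 1)
    rw [h, h1, d.d_self] at this
    norm_num at this
  · have := hc (t + 1) t
    rw [h, ExtMetric.d_rem hrem h1] at this
    exact ENNReal.ofReal_ne_top this.symm

theorem fd_of_dist {X : Type*} {d : ExtMetric X}
    {c : ℝ → X} (hc : ∀ s t : ℝ, d.d (c s) (c t) = ENNReal.ofReal |s - t|) (s t : ℝ) :
    d.fd (c s) (c t) = |s - t| := by
  simp [ExtMetric.fd, hc]

theorem injective_of_dist {X : Type*} {d : ExtMetric X}
    {c : ℝ → X} (hc : ∀ s t : ℝ, d.d (c s) (c t) = ENNReal.ofReal |s - t|) :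
    Function.Injective c := by
  intro s t h
  have := fd_of_dist hc s t
  rw [h, d.fd_self] at this
  exact sub_eq_zero.1 (abs_eq_zero.1 this.symm)

theorem IsInversionAt.map_line {X : Type*} {S : MobiusStructure X} {ω p : X}
    {d : ExtMetric X} (hrem : d.rem = some ω) {R : ℝ} {φ : X → X}
    (hφ : IsInversionAt S d ω p R φ) {l : Set X} (hl : IsPtolemyLine S ω l) {c : ℝ → X}
    (hc : IsUnitSpeed d l c) (hp : c 0 = p) {u : ℝ} (hu : u ≠ 0) :
    φ (c u) = c (-R / u) := by
  obtain ⟨σ, hσ, hωσ, rfl⟩ := hl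
  obtain ⟨hr, hc⟩ := hc
  have hinj := injective_of_dist hc
  have hcω := ne_of_dist hrem hc
  have hcσ : ∀ t, c t ∈ σ := fun t => (hr ▸ Set.mem_range_self t : c t ∈ σ \ {ω}).1
  have him := hφ.image_circle σ hσ hωσ (hp ▸ hcσ 0)
  have hcp : ∀ t, t ≠ 0 → c t ≠ p := fun t ht h => ht (hinj (h.trans hp.symm))
  have hτ : ∀ t, t ≠ 0 → ∃ s, φ (c t) = c s := by
    intro t ht
    have h1 : φ (c t) ∈ σ \ {ω} := by
      refine ⟨him ▸ Set.mem_image_of_mem φ (hcσ t), fun h => hcp t ht ?_⟩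
      rw [← hφ.invol (c t), Set.mem_singleton_iff.1 h, ← hφ.map_center, hφ.invol]
    rw [← hr] at h1
    exact h1.imp fun _ h => h.symm
  have habs : ∀ t s, t ≠ 0 → φ (c t) = c s → |s| * |t| = R := by
    intro t s ht h
    have := hφ.fd_center (c t) (hcω t) (hcp t ht)
    rw [h, ← hp, fd_of_dist hc, fd_of_dist hc] at this
    simpa using this
  have hdist : ∀ t s t' s', t ≠ 0 → t' ≠ 0 → φ (c t) = c s → φ (c t') = c s' →
      |s - s'| * (|t| * |t'|) = R * |t - t'| := by
    intro t s t' s' ht ht' h h'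
    have := hφ.fd_map (c t) (c t') (hcω t) (hcp t ht) (hcω t') (hcp t' ht')
    rw [h, h', ← hp, fd_of_dist hc, fd_of_dist hc, fd_of_dist hc, fd_of_dist hc] at this
    simpa using this
  have hR := hφ.pos
  have cand : ∀ t s, t ≠ 0 → φ (c t) = c s → s = R / t ∨ s = -R / t := by
    intro t s ht h
    have h1 := habs t s ht h
    rw [← abs_mul] at h1
    rcases abs_eq hR.le |>.1 h1 with h2 | h2
    · left; field_simp; exact h2
    · right; field_simp; exact h2
  set q := Real.sqrt R with hq
  have hq0 : 0 < q := Real.sqrt_pos.2 hR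
  have hqq : R = q * q := (Real.mul_self_sqrt hR.le).symm
  have hsq : φ (c q) = c (-q) := by
    obtain ⟨s, hs⟩ := hτ q hq0.ne'
    rcases cand q s hq0.ne' hs with h | h
    · rw [hqq, mul_div_assoc, div_self hq0.ne', mul_one] at h
      exact absurd (h ▸ hs) (hφ.ne_self _)
    · rw [hqq, neg_div, mul_div_assoc, div_self hq0.ne', mul_one] at h
      rw [hs, h]
  obtain ⟨s, hs⟩ := hτ u hu
  rcases cand u s hu hs with h | h
  · exfalso
    have h1 := hdist u s q (-q) hu hq0.ne' hs hsq
    rw [h, ← abs_mul, ← abs_mul, hqq,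
      show (q * q / u - -q) * (u * q) = q * q * (u + q) by field_simp; ring, abs_mul,
      abs_of_pos (mul_pos hq0 hq0)] at h1
    have h2 := mul_left_cancel₀ (mul_pos hq0 hq0).ne' h1
    rw [← sq_eq_sq_iff_abs_eq_abs] at h2
    have : u * q = 0 := by nlinarith
    rcases mul_eq_zero.1 this with h3 | h3
    · exact hu h3
    · exact hq0.ne' h3
  · rw [hs, h]

/-- If the cross-ratio of `y i, y₀, p, q` tends to zero, then `y i` tends to `y₀` with respect
to every metric of the Möbius structure. -/
theorem tendsto_d_of_ratio {X ι : Type*} {S : MobiusStructure X} {d d' : ExtMetric X}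
    (hd : d ∈ S.M) (hd' : d' ∈ S.M) {L : Filter ι} {y : ι → X} {y₀ p q : X}
    (hp : y₀ ≠ p) (hq : y₀ ≠ q) (hpq : p ≠ q) (hyp : ∀ᶠ i in L, y i ≠ p)
    (h : Filter.Tendsto (fun i => d.fd (y i) y₀ / d.fd (y i) p) L (nhds 0))
    {x : X} (hx : d'.rem ≠ some x) :
    Filter.Tendsto (fun i => d'.d (y i) x) L (nhds (d'.d y₀ x)) := by
  have hr : Filter.Tendsto (fun i => d'.fd (y i) y₀ / d'.fd (y i) p) L (nhds 0) := by
    have h1 := h.mul_const (d.fd p q * d'.fd y₀ q / (d.fd y₀ q * d'.fd p q))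
    rw [zero_mul] at h1
    refine h1.congr' (hyp.mono fun i hi => ?_)
    obtain ⟨lam, hl, hcr⟩ := S.compat d hd d' hd' (y i) y₀ p q
      ⟨fun h => hp h.2, fun h => hq h.2, fun h => hpq h.2, fun h => hpq h.2⟩
    simp only [crtVec, Prod.smul_mk, smul_eq_mul, Prod.mk.injEq] at hcr
    obtain ⟨h1, h2, -⟩ := hcr
    have e1 := d.fd_pos hi
    have e2 := d'.fd_pos hi
    have e3 := d.fd_pos hq
    have e4 := d'.fd_pos hpq
    rw [div_mul_div_comm, div_eq_div_iff (by positivity) (by positivity)]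
    apply mul_left_cancel₀ hl.ne'
    calc _ = (lam * (d.fd (y i) y₀ * d.fd p q)) * d'.fd y₀ q * d'.fd (y i) p := by ring
      _ = d'.fd (y i) y₀ * d'.fd p q * (d'.fd (y i) p * d'.fd y₀ q) := by rw [← h1]; ring
      _ = _ := by rw [h2]; ring
  clear h
  by_cases hrem : d'.rem = some y₀
  · have hxy : y₀ ≠ x := fun h => hx (h ▸ hrem)
    have hpr : d'.rem ≠ some p := fun h => hp (Option.some.inj (hrem.symm.trans h))
    rw [d'.symm y₀, ExtMetric.d_rem hrem hxy.symm, ENNReal.tendsto_nhds_top_iff_nnreal]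
    intro N
    have hpos : 0 < (N : ℝ) + d'.fd x p + 1 := by
      have := d'.fd_nonneg x p
      positivity
    filter_upwards [hyp, hr.eventually (gt_mem_nhds (inv_pos.2 hpos))] with i hi hlt
    by_cases hiy : y i = y₀
    · rw [hiy, d'.symm y₀, ExtMetric.d_rem hrem hxy.symm]
      exact ENNReal.coe_lt_top
    · have hyr : d'.rem ≠ some (y i) := fun h => hiy (Option.some.inj (h.symm.trans hrem))
      rw [ExtMetric.fd_rem hrem hiy, one_div, inv_lt_inv₀ (d'.fd_pos hi) hpos] at hlt
      have h1 := ExtMetric.fd_triangle hyr hx hpr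
      rw [← ExtMetric.ofReal_fd hyr hx, ← ENNReal.ofReal_coe_nnreal]
      refine (ENNReal.ofReal_lt_ofReal_iff_of_nonneg N.2).2 ?_
      have : (N : ℝ) < d'.fd (y i) x := by linarith
      exact this
  · have hyr : ∀ᶠ i in L, d'.rem ≠ some (y i) := by
      filter_upwards [hyp, hr.eventually (gt_mem_nhds one_pos)] with i hi hlt h
      have hne : y₀ ≠ y i := fun h' => hrem (h' ▸ h)
      rw [ExtMetric.fd_rem' h hne, ExtMetric.fd_rem' h hi.symm] at hlt
      norm_num at hlt
    have h0 : Filter.Tendsto (fun i => d'.fd (y i) y₀) L (nhds 0) := by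
      have h2 := hr.mul_const (2 * (d'.fd y₀ p + 1))
      rw [zero_mul] at h2
      refine squeeze_zero' (Filter.Eventually.of_forall fun i => d'.fd_nonneg _ _) ?_ h2
      filter_upwards [hyp, hyr, hr.eventually (gt_mem_nhds (show (0 : ℝ) < 1 / 2 by norm_num))]
        with i hi hir hlt
      have e1 := d'.fd_pos hi
      have hle : d'.fd (y i) p ≤ d'.fd (y i) y₀ + d'.fd y₀ p + 1 := by
        by_cases hpr : d'.rem = some p
        · rw [ExtMetric.fd_rem hpr hi]
          linarith [d'.fd_nonneg (y i) y₀, d'.fd_nonneg y₀ p]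
        · linarith [ExtMetric.fd_triangle hir hrem hpr]
      have heq : d'.fd (y i) y₀ = d'.fd (y i) y₀ / d'.fd (y i) p * d'.fd (y i) p := by
        field_simp
      have hnn : 0 ≤ d'.fd (y i) y₀ / d'.fd (y i) p := div_nonneg (d'.fd_nonneg _ _) e1.le
      set r := d'.fd (y i) y₀ / d'.fd (y i) p
      have h3 := mul_le_mul_of_nonneg_left hle hnn
      have h4 := mul_le_mul_of_nonneg_right hlt.le (d'.fd_nonneg (y i) y₀)
      linarith
    have h1 : Filter.Tendsto (fun i => d'.fd (y i) x) L (nhds (d'.fd y₀ x)) := by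
      rw [tendsto_iff_dist_tendsto_zero]
      refine squeeze_zero' (Filter.Eventually.of_forall fun i => dist_nonneg) ?_ h0
      filter_upwards [hyr] with i hir
      rw [Real.dist_eq, abs_le]
      have t1 := ExtMetric.fd_triangle hir hrem hx
      have t2 := ExtMetric.fd_triangle hrem hir hx
      rw [d'.fd_symm y₀ (y i)] at t2
      constructor <;> linarith
    rw [← ExtMetric.ofReal_fd hrem hx]
    refine (ENNReal.tendsto_ofReal h1).congr' (hyr.mono fun i hir => ?_)
    rw [ExtMetric.ofReal_fd hir hx]

theorem tendsto_mobiusTop_of_ratio {X ι : Type*} {S : MobiusStructure X} {d : ExtMetric X}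
    (hd : d ∈ S.M) {L : Filter ι} {y : ι → X} {y₀ p q : X}
    (hp : y₀ ≠ p) (hq : y₀ ≠ q) (hpq : p ≠ q) (hyp : ∀ᶠ i in L, y i ≠ p)
    (h : Filter.Tendsto (fun i => d.fd (y i) y₀ / d.fd (y i) p) L (nhds 0)) :
    Filter.Tendsto y L (@nhds X (mobiusTop S) y₀) := by
  refine TopologicalSpace.tendsto_nhds_generateFrom_iff.2 ?_
  rintro s ⟨d', hd', x, hx, r, -, -, rfl | rfl⟩ hy
  · exact (tendsto_d_of_ratio hd hd' hp hq hpq hyp h hx).eventually (gt_mem_nhds hy)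
  · exact (tendsto_d_of_ratio hd hd' hp hq hpq hyp h hx).eventually (lt_mem_nhds hy)

theorem t2Space_mobiusTop {X : Type*} {S : MobiusStructure X} {ω : X} {d : ExtMetric X}
    (hd : d ∈ S.M) (hrem : d.rem = some ω) : @T2Space X (mobiusTop S) := by
  let _ : TopologicalSpace X := mobiusTop S
  have hball : ∀ x, x ≠ ω → ∀ r : ℝ≥0∞, 0 < r → r ≠ ⊤ →
      IsOpen {y | d.d y x < r} ∧ IsOpen {y | r < d.d y x} := by
    intro x hx r h0 h1
    have hx' : d.rem ≠ some x := fun h => hx (Option.some.inj (h.symm.trans hrem))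
    exact ⟨TopologicalSpace.isOpen_generateFrom_of_mem
        ⟨d, hd, x, hx', r, h0, h1, Or.inl rfl⟩,
      TopologicalSpace.isOpen_generateFrom_of_mem ⟨d, hd, x, hx', r, h0, h1, Or.inr rfl⟩⟩
  have hsep : ∀ x, x ≠ ω → ∀ y, y ≠ x → ∃ u v : Set X, IsOpen u ∧ IsOpen v ∧ x ∈ u ∧ y ∈ v ∧
      Disjoint u v := by
    intro x hx y hxy
    obtain ⟨r, h0, h1⟩ := exists_between (d.pos y x hxy)
    obtain ⟨o1, o2⟩ := hball x hx r h0 h1.ne_top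
    refine ⟨_, _, o1, o2, by simpa [d.d_self] using h0, h1, ?_⟩
    rw [Set.disjoint_left]
    intro z hz hz'
    exact lt_asymm (show d.d z x < r from hz) hz'
  refine ⟨fun x y hxy => ?_⟩
  by_cases hx : x = ω
  · obtain ⟨u, v, hu, hv, h1, h2, h3⟩ := hsep y (hx ▸ hxy.symm) x hxy
    exact ⟨v, u, hv, hu, h2, h1, h3.symm⟩
  · exact hsep x hx y hxy.symm

section Line

variable {X : Type*} {S : MobiusStructure X} {ω : X} {d : ExtMetric X} {c : ℝ → X}

theorem continuous_of_dist (hd : d ∈ S.M) (hrem : d.rem = some ω)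
    (hc : ∀ s t : ℝ, d.d (c s) (c t) = ENNReal.ofReal |s - t|) :
    @Continuous ℝ X _ (mobiusTop S) c := by
  let _ : TopologicalSpace X := mobiusTop S
  have hcω := ne_of_dist hrem hc
  refine continuous_iff_continuousAt.2 fun t => ?_
  refine tendsto_mobiusTop_of_ratio hd (p := ω) (q := c (t + 1)) (hcω t) ?_ (hcω _).symm
    (Filter.Eventually.of_forall hcω) ?_
  · intro h
    have := injective_of_dist hc h
    linarith
  · have : Continuous fun s : ℝ => |s - t| := by fun_prop
    have h := this.tendsto t
    simp only [sub_self, abs_zero] at h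
    refine h.congr fun s => ?_
    rw [fd_of_dist hc, ExtMetric.fd_rem hrem (hcω s), div_one]

theorem tendsto_cocompact_of_dist (hd : d ∈ S.M) (hrem : d.rem = some ω)
    (hc : ∀ s t : ℝ, d.d (c s) (c t) = ENNReal.ofReal |s - t|) :
    Filter.Tendsto c (Filter.cocompact ℝ) (@nhds X (mobiusTop S) ω) := by
  have hcω := ne_of_dist hrem hc
  refine tendsto_mobiusTop_of_ratio hd (p := c 0) (q := c 1) (hcω 0).symm (hcω 1).symm ?_ ?_ ?_
  · intro h
    have := injective_of_dist hc h
    norm_num at this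
  · have : ({0} : Set ℝ)ᶜ ∈ Filter.cocompact ℝ := isCompact_singleton.compl_mem_cocompact
    filter_upwards [this] with t ht h
    exact ht (injective_of_dist hc h)
  · have h := (tendsto_norm_cocompact_atTop (E := ℝ)).inv_tendsto_atTop
    refine h.congr fun s => ?_
    rw [fd_of_dist hc, ExtMetric.fd_rem hrem (hcω s), sub_zero, one_div]
    rfl

theorem homeoToCircle_of_dist (hd : d ∈ S.M) (hrem : d.rem = some ω)
    (hc : ∀ s t : ℝ, d.d (c s) (c t) = ENNReal.ofReal |s - t|) :
    HomeoToCircle S (insert ω (Set.range c)) := by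
  let _ : TopologicalSpace X := mobiusTop S
  have : T2Space X := t2Space_mobiusTop hd hrem
  have hcω := ne_of_dist hrem hc
  let G : OnePoint ℝ → X := fun a => a.elim ω c
  have hG : Continuous G := by
    rw [OnePoint.continuous_iff]
    refine ⟨?_, continuous_of_dist hd hrem hc⟩
    rw [Filter.coclosedCompact_eq_cocompact]
    exact tendsto_cocompact_of_dist hd hrem hc
  have hGinj : Function.Injective G := by
    intro a b h
    induction a using OnePoint.rec <;> induction b using OnePoint.rec
    · rfl
    · exact absurd h.symm (hcω _)
    · exact absurd h (hcω _)
    · exact congrArg _ (injective_of_dist hc h)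
  have hrange : Set.range G = insert ω (Set.range c) := by
    ext z
    constructor
    · rintro ⟨a, rfl⟩
      induction a using OnePoint.rec
      · exact Or.inl rfl
      · exact Or.inr ⟨_, rfl⟩
    · rintro (rfl | ⟨t, rfl⟩)
      · exact ⟨OnePoint.infty, rfl⟩
      · exact ⟨(t : OnePoint ℝ), rfl⟩
  have e1 : OnePoint ℝ ≃ₜ (insert ω (Set.range c) : Set X) :=
    (hG.isClosedEmbedding hGinj).isEmbedding.toHomeomorph.trans (Homeomorph.setCongr hrange)
  have hfin : Module.finrank ℝ ℂ = 1 + 1 := Complex.finrank_real_complex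
  have : Fact (Module.finrank ℝ ℂ = 1 + 1) := ⟨hfin⟩
  have hV : Module.finrank ℝ ℝ = Module.finrank ℝ (Submodule.span ℝ {(1 : ℂ)})ᗮ := by
    rw [Submodule.finrank_orthogonal_span_singleton (n := 1) one_ne_zero, Module.finrank_self]
  have e : ℝ ≃ₜ (Submodule.span ℝ {(1 : ℂ)})ᗮ :=
    (FiniteDimensional.nonempty_continuousLinearEquiv_of_finrank_eq hV).some.toHomeomorph
  exact ⟨e1.symm.trans
    (e.onePointCongr.trans (onePointHyperplaneHomeoUnitSphere (E := ℂ) norm_one))⟩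

end Line

theorem abs_sub_eq_add_of_mem_uIcc {x y z : ℝ} (h : y ∈ Set.uIcc x z) :
    |x - z| = |x - y| + |y - z| := by
  rcases Set.mem_uIcc.1 h with ⟨h1, h2⟩ | ⟨h1, h2⟩
  · rw [abs_of_nonpos (by linarith), abs_of_nonpos (by linarith), abs_of_nonpos (by linarith)]
    ring
  · rw [abs_of_nonneg (by linarith), abs_of_nonneg (by linarith), abs_of_nonneg (by linarith)]
    ring

/-- The Ptolemy equality on the real line for interlacing pairs `x, z` and `y, u`. -/
theorem abs_ptolemy {x y z u : ℝ} (hxy : x ≠ y) (hxu : x ≠ u) (hyz : y ≠ z) (hzu : z ≠ u)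
    (h1 : x ∈ Set.uIcc y u ∨ z ∈ Set.uIcc y u) (h2 : y ∈ Set.uIcc x z ∨ u ∈ Set.uIcc x z) :
    |x - z| * |y - u| = |x - y| * |z - u| + |x - u| * |y - z| := by
  simp only [Set.mem_uIcc] at h1 h2
  rcases hxy.lt_or_gt with a1 | a1 <;> rcases hxu.lt_or_gt with a2 | a2 <;>
  rcases hyz.lt_or_gt with a3 | a3 <;> rcases hzu.lt_or_gt with a4 | a4 <;>
  first
  | (exfalso
     rcases h1 with (h1 | h1) | (h1 | h1) <;> rcases h2 with (h2 | h2) | (h2 | h2) <;> linarith)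
  | (rcases le_total x z with a5 | a5 <;> rcases le_total y u with a6 | a6 <;>
     first
     | (exfalso; linarith)
     | (simp only [abs_of_nonneg, abs_of_nonpos, sub_nonneg, sub_nonpos, a1.le, a2.le, a3.le,
          a4.le, a5, a6]
        ring))

/-- The Ptolemy equality does not depend on the metric of the Möbius structure. -/
theorem ptolemy_of_fd {X : Type*} {S : MobiusStructure X} {d d' : ExtMetric X}
    (hd : d ∈ S.M) (hd' : d' ∈ S.M) {x y z u : X} (hxy : x ≠ y) (hxz : x ≠ z)
    (hyz : y ≠ z) (hyu : y ≠ u) (hzu : z ≠ u)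
    (h : d.fd x z * d.fd y u = d.fd x y * d.fd z u + d.fd x u * d.fd y z) :
    d'.d x z * d'.d y u = d'.d x y * d'.d z u + d'.d x u * d'.d y z := by
  have hpos : ∀ {a b : X}, a ≠ b → d'.d a b ≠ 0 := fun h => (d'.pos _ _ h).ne'
  have htop : ∀ {a b : X}, d'.rem = some b → a ≠ b → d'.d a b = ⊤ := ExtMetric.d_rem
  have htop' : ∀ {a b : X}, d'.rem = some b → a ≠ b → d'.d b a = ⊤ := fun h hab => by
    rw [d'.symm, htop h hab]
  by_cases hx : d'.rem = some x
  · rw [htop' hx hxz.symm, htop' hx hxy.symm, ENNReal.top_mul (hpos hyu),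
      ENNReal.top_mul (hpos hzu), top_add]
  by_cases hy : d'.rem = some y
  · rw [htop' hy hyu.symm, htop hy hxy, ENNReal.mul_top (hpos hxz), ENNReal.top_mul (hpos hzu),
      top_add]
  by_cases hz : d'.rem = some z
  · rw [htop hz hxz, htop' hz hzu.symm, ENNReal.top_mul (hpos hyu), ENNReal.mul_top (hpos hxy),
      top_add]
  by_cases hu : d'.rem = some u
  · rw [htop hu hyu, htop hu hzu, ENNReal.mul_top (hpos hxz), ENNReal.mul_top (hpos hxy),
      top_add]
  obtain ⟨lam, -, hcr⟩ := S.compat d hd d' hd' x y z u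
    ⟨fun h => hxy h.1, fun h => hxy h.1, fun h => hxz h.1, fun h => hyz h.1⟩
  simp only [crtVec, Prod.smul_mk, smul_eq_mul, Prod.mk.injEq] at hcr
  obtain ⟨h1, h2, h3⟩ := hcr
  have nn := d'.fd_nonneg
  rw [← ExtMetric.ofReal_fd hx hz, ← ExtMetric.ofReal_fd hy hu, ← ExtMetric.ofReal_fd hx hy,
    ← ExtMetric.ofReal_fd hz hu, ← ExtMetric.ofReal_fd hx hu, ← ExtMetric.ofReal_fd hy hz,
    ← ENNReal.ofReal_mul (nn _ _), ← ENNReal.ofReal_mul (nn _ _), ← ENNReal.ofReal_mul (nn _ _),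
    ← ENNReal.ofReal_add (mul_nonneg (nn _ _) (nn _ _)) (mul_nonneg (nn _ _) (nn _ _)),
    h1, h2, h3, h, mul_add]

section Line

variable {X : Type*} {S : MobiusStructure X} {ω : X} {d : ExtMetric X} {c : ℝ → X}

theorem isPreconnected_image_of_dist (hd : d ∈ S.M) (hrem : d.rem = some ω)
    (hc : ∀ s t : ℝ, d.d (c s) (c t) = ENNReal.ofReal |s - t|) {I : Set ℝ}
    (hI : IsPreconnected I) : @IsPreconnected X (mobiusTop S) (c '' I) := by
  let _ : TopologicalSpace X := mobiusTop S
  exact hI.image c (continuous_of_dist hd hrem hc).continuousOn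

theorem isPreconnected_insert_of_dist (hd : d ∈ S.M) (hrem : d.rem = some ω)
    (hc : ∀ s t : ℝ, d.d (c s) (c t) = ENNReal.ofReal |s - t|) (a b : ℝ) :
    @IsPreconnected X (mobiusTop S) (insert ω (c '' (Set.Iio a ∪ Set.Ioi b))) := by
  let _ : TopologicalSpace X := mobiusTop S
  have key : ∀ (I : Set ℝ) (F : Filter ℝ), F.NeBot → F ≤ Filter.cocompact ℝ → I ∈ F →
      IsPreconnected I → IsPreconnected (insert ω (c '' I)) := by
    intro I F _ hF hIF hI
    refine (isPreconnected_image_of_dist hd hrem hc hI).subset_closure (Set.subset_insert _ _) ?_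
    refine Set.insert_subset ?_ subset_closure
    refine mem_closure_of_tendsto ((tendsto_cocompact_of_dist hd hrem hc).mono_left hF) ?_
    exact Filter.mem_of_superset hIF fun t ht => Set.mem_image_of_mem c ht
  have h1 := key (Set.Iio a) Filter.atBot inferInstance
    (by rw [cocompact_eq_atBot_atTop]; exact le_sup_left) (Filter.Iio_mem_atBot a)
    isPreconnected_Iio
  have h2 := key (Set.Ioi b) Filter.atTop inferInstance
    (by rw [cocompact_eq_atBot_atTop]; exact le_sup_right) (Filter.Ioi_mem_atTop b)
    isPreconnected_Ioi
  rw [Set.image_union, Set.insert_union_distrib]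
  exact h1.union ω (Set.mem_insert _ _) (Set.mem_insert _ _) h2

theorem isPtolemyLine_of_dist (hd : d ∈ S.M) (hrem : d.rem = some ω)
    (hc : ∀ s t : ℝ, d.d (c s) (c t) = ENNReal.ofReal |s - t|) :
    IsPtolemyLine S ω (Set.range c) := by
  have hcω := ne_of_dist hrem hc
  have hinj := injective_of_dist hc
  refine ⟨insert ω (Set.range c), ⟨homeoToCircle_of_dist hd hrem hc, ?_⟩, Set.mem_insert _ _, ?_⟩
  swap
  · rw [Set.insert_sdiff_self_of_notMem]
    rintro ⟨t, ht⟩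
    exact hcω t ht
  intro d' hd' x hx y hy z hz u hu hxy hxz hxu hyz hyu hzu hsep
  refine ptolemy_of_fd hd hd' hxy hxz hyz hyu hzu ?_
  have hconn : ∀ T : Set X, @IsPreconnected X (mobiusTop S) T → y ∈ T →
      T ⊆ insert ω (Set.range c) → u ∈ T → x ∈ T ∨ z ∈ T := by
    intro T hT hyT hTσ huT
    by_contra! hno
    refine hsep (Set.mem_of_subset_of_mem
      (@IsPreconnected.subset_connectedComponentIn X (mobiusTop S) _ _ _ hT hyT ?_) huT)
    rintro w hw
    refine ⟨hTσ hw, ?_⟩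
    rintro (rfl | rfl)
    · exact hno.1 hw
    · exact hno.2 hw
  have hI : ∀ {y' u' : ℝ}, c y' = y → c u' = u →
      x ∈ c '' Set.uIcc y' u' ∨ z ∈ c '' Set.uIcc y' u' := by
    rintro y' u' rfl rfl
    exact hconn _ (isPreconnected_image_of_dist hd hrem hc isPreconnected_uIcc)
      (Set.mem_image_of_mem _ Set.left_mem_uIcc)
      ((Set.image_subset_range _ _).trans (Set.subset_insert _ _))
      (Set.mem_image_of_mem _ Set.right_mem_uIcc)
  have hJ : ∀ {x' z' : ℝ}, c x' = x → c z' = z →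
      ¬ (y ∈ insert ω (c '' (Set.uIcc x' z')ᶜ) ∧ u ∈ insert ω (c '' (Set.uIcc x' z')ᶜ)) := by
    rintro x' z' rfl rfl ⟨h1, h2⟩
    have hT := isPreconnected_insert_of_dist hd hrem hc (min x' z') (max x' z')
    have heq : Set.Iio (min x' z') ∪ Set.Ioi (max x' z') = (Set.uIcc x' z')ᶜ := by
      ext t
      simp only [Set.uIcc, Set.mem_union, Set.mem_Iio, Set.mem_Ioi, Set.mem_compl_iff,
        Set.mem_Icc, not_and_or, not_le]
    rw [heq] at hT
    rcases hconn _ hT h1 (Set.insert_subset_insert (Set.image_subset_range _ _)) h2 with h | h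
    · rcases h with h | ⟨t, ht, h⟩
      · exact hcω _ h
      · exact ht (hinj h ▸ Set.left_mem_uIcc)
    · rcases h with h | ⟨t, ht, h⟩
      · exact hcω _ h
      · exact ht (hinj h ▸ Set.right_mem_uIcc)
  have hmem : ∀ {t : ℝ} {I : Set ℝ}, c t ∈ c '' I → t ∈ I := fun h => hinj.mem_set_image.1 h
  have hω1 := fun t => ExtMetric.fd_rem hrem (hcω t)
  have hω2 := fun t => ExtMetric.fd_rem' hrem (hcω t)
  have hnot : ∀ I : Set ℝ, ω ∉ c '' I := fun I ⟨t, _, h⟩ => hcω t h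
  rcases hx with rfl | ⟨x, rfl⟩
  · obtain ⟨y, rfl⟩ := hy.resolve_left hxy.symm
    obtain ⟨z, rfl⟩ := hz.resolve_left hxz.symm
    obtain ⟨u, rfl⟩ := hu.resolve_left hxu.symm
    have := abs_sub_eq_add_of_mem_uIcc (hmem ((hI rfl rfl).resolve_left (hnot _)))
    simp only [hω2, fd_of_dist hc]
    linarith
  rcases hz with rfl | ⟨z, rfl⟩
  · obtain ⟨y, rfl⟩ := hy.resolve_left hyz
    obtain ⟨u, rfl⟩ := hu.resolve_left hzu.symm
    have := abs_sub_eq_add_of_mem_uIcc (hmem ((hI rfl rfl).resolve_right (hnot _)))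
    simp only [hω1, hω2, fd_of_dist hc]
    rw [abs_sub_comm x y]
    linarith
  have hJ' := hJ rfl rfl
  rcases hy with rfl | ⟨y, rfl⟩
  · obtain ⟨u, rfl⟩ := hu.resolve_left hyu.symm
    have hu' : u ∈ Set.uIcc x z := by
      by_contra h
      exact hJ' ⟨Or.inl rfl, Or.inr (Set.mem_image_of_mem c h)⟩
    have := abs_sub_eq_add_of_mem_uIcc hu'
    simp only [hω1, hω2, fd_of_dist hc]
    rw [abs_sub_comm z u]
    linarith
  rcases hu with rfl | ⟨u, rfl⟩
  · have hy' : y ∈ Set.uIcc x z := by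
      by_contra h
      exact hJ' ⟨Or.inr (Set.mem_image_of_mem c h), Or.inl rfl⟩
    have := abs_sub_eq_add_of_mem_uIcc hy'
    simp only [hω1, fd_of_dist hc]
    linarith
  simp only [fd_of_dist hc]
  refine abs_ptolemy (fun h => hxy (h ▸ rfl)) (fun h => hxu (h ▸ rfl)) (fun h => hyz (h ▸ rfl))
    (fun h => hzu (h ▸ rfl)) ((hI rfl rfl).imp hmem hmem) ?_
  by_contra! h
  exact hJ' ⟨Or.inr (Set.mem_image_of_mem c h.1), Or.inr (Set.mem_image_of_mem c h.2)⟩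

end Line

/-- Two unit-speed Ptolemy lines with a common ray coincide. -/
theorem eq_of_eqOn_ray {X : Type*} {S : MobiusStructure X} (hI : PropertyI S)
    {ω : X} {d : ExtMetric X} (hd : d ∈ S.M) (hrem : d.rem = some ω) {c₁ c₂ : ℝ → X}
    (h₁ : ∀ s t : ℝ, d.d (c₁ s) (c₁ t) = ENNReal.ofReal |s - t|)
    (h₂ : ∀ s t : ℝ, d.d (c₂ s) (c₂ t) = ENNReal.ofReal |s - t|)
    (heq : ∀ t, 0 ≤ t → c₁ t = c₂ t) : c₁ = c₂ := by
  have hshift : ∀ c : ℝ → X, (∀ s t : ℝ, d.d (c s) (c t) = ENNReal.ofReal |s - t|) →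
      ∀ s t : ℝ, d.d (c (s + 1)) (c (t + 1)) = ENNReal.ofReal |s - t| := by
    intro c hc s t
    rw [hc, add_sub_add_right_eq_sub]
  obtain ⟨R, φ, hφ⟩ := exists_isInversionAt hI hd hrem (p := c₁ 1) (x₀ := c₁ 0)
    (ne_of_dist hrem h₁ 1) (ne_of_dist hrem h₁ 0) fun h => zero_ne_one (injective_of_dist h₁ h)
  have hmap : ∀ c : ℝ → X, (∀ s t : ℝ, d.d (c s) (c t) = ENNReal.ofReal |s - t|) →
      c 1 = c₁ 1 → ∀ u : ℝ, u ≠ 0 → φ (c (u + 1)) = c (-R / u + 1) := by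
    intro c hc h u hu
    exact hφ.map_line hrem (isPtolemyLine_of_dist hd hrem (hshift c hc))
      (c := fun t => c (t + 1)) ⟨rfl, hshift c hc⟩ (by simpa using h) hu
  funext t
  rcases le_or_gt 0 t with ht | ht
  · exact heq t ht
  · have hu : t - 1 ≠ 0 := by linarith
    have e1 := hmap c₁ h₁ rfl (t - 1) hu
    have e2 := hmap c₂ h₂ (heq 1 zero_le_one).symm (t - 1) hu
    rw [sub_add_cancel] at e1 e2
    apply hφ.invol.injective
    rw [e1, e2]
    apply heq
    have : 0 < -R / (t - 1) := div_pos_of_neg_of_neg (neg_lt_zero.2 hφ.pos) (by linarith)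
    linarith

/-- If the Busemann function of a line decreases at unit speed along the positive ray of another
line, then the negative ray of the latter and the positive ray of the former form a geodesic. -/
theorem fd_eq_add_of_busemann {X : Type*} {S : MobiusStructure X} (hpt : IsPtolemyStructure S)
    (hI : PropertyI S) {ω : X} {d : ExtMetric X} (hd : d ∈ S.M) (hrem : d.rem = some ω)
    {l l' : Set X} (hl : IsPtolemyLine S ω l) (hl' : IsPtolemyLine S ω l')
    {c c' : ℝ → X} (hc : IsUnitSpeed d l c) (hc' : IsUnitSpeed d l' c') (h0 : c 0 = c' 0)
    (hb : ∀ t : ℝ, 0 ≤ t →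
      Filter.Tendsto (fun s => (d.d (c' t) (c s)).toReal - s) Filter.atTop (nhds (-t)))
    {a v : ℝ} (ha : 0 ≤ a) (hv : 0 ≤ v) : d.fd (c' (-a)) (c v) = a + v := by
  have hcω := ne_of_dist hrem hc.2
  have hcω' := ne_of_dist hrem hc'.2
  have hne : ∀ x, x ≠ ω → d.rem ≠ some x := fun x hx h => hx (Option.some.inj (h.symm.trans hrem))
  rcases ha.eq_or_lt with rfl | ha
  · rw [neg_zero, ← h0, fd_of_dist hc.2, zero_sub, abs_neg, abs_of_nonneg hv, zero_add]
  rcases hv.eq_or_lt with rfl | hv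
  · rw [h0, fd_of_dist hc'.2, sub_zero, abs_neg, abs_of_pos ha, add_zero]
  have hU : d.fd (c' (-a)) (c 0) = a := by
    rw [h0, fd_of_dist hc'.2, sub_zero, abs_neg, abs_of_pos ha]
  apply le_antisymm
  · have h := ExtMetric.fd_triangle (hne _ (hcω' (-a))) (hne _ (hcω 0)) (hne _ (hcω v))
    rwa [hU, fd_of_dist hc.2, zero_sub, abs_neg, abs_of_pos hv] at h
  have hinj := injective_of_dist hc.2
  have hinj' := injective_of_dist hc'.2
  have hcp : ∀ t, t ≠ 0 → c t ≠ c 0 := fun t ht h => ht (hinj h)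
  have hcp' : ∀ t, t ≠ 0 → c' t ≠ c 0 := fun t ht h => ht (hinj' (h.trans h0))
  obtain ⟨R, φ, hφ⟩ := exists_isInversionAt hI hd hrem (p := c 0) (x₀ := c 1)
    (hcω 0) (hcω 1) (hcp 1 one_ne_zero)
  have hR := hφ.pos
  have ht : 0 < R / a := div_pos hR ha
  have hlim := hb (R / a) ht.le
  have hlim2 := (((hlim.add_const (R / a)).mul_const (a * v / R)).neg).add_const (a + v)
  rw [neg_add_cancel, zero_mul, neg_zero, zero_add] at hlim2
  refine le_of_tendsto hlim2 ?_
  filter_upwards [Filter.eventually_gt_atTop 0] with s hs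
  rw [← ExtMetric.fd_eq_toReal (hne _ (hcω' _)) (hne _ (hcω _))]
  set g := d.fd (c' (R / a)) (c s) with hg
  have hε : 0 < R / s := div_pos hR hs
  have hdist : d.fd (c' (-a)) (c (-(R / s))) * (R / a * s) = R * g := by
    have h := hφ.fd_map (c' (R / a)) (c s) (hcω' _) (hcp' _ ht.ne') (hcω _) (hcp _ hs.ne')
    rw [hφ.map_line hrem hl' hc' h0.symm ht.ne', hφ.map_line hrem hl hc rfl hs.ne',
      fd_of_dist hc.2, h0, fd_of_dist hc'.2, sub_zero, sub_zero, abs_of_pos ht, abs_of_pos hs,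
      neg_div, neg_div, div_div_cancel₀ hR.ne'] at h
    exact h
  have hptol := (hpt d hd (c' (-a)) (c (-(R / s))) (c 0) (c v) ⟨?_, ?_, ?_, ?_⟩).2.1
  · simp only [crtVec, hU, fd_of_dist hc.2] at hptol
    rw [zero_sub, abs_neg, abs_of_pos hv, sub_zero, abs_neg, abs_of_pos hε, abs_sub_comm,
      abs_of_pos (by linarith)] at hptol
    have hdist' : d.fd (c' (-a)) (c (-(R / s))) = a * g / s := by
      field_simp at hdist ⊢
      linarith
    rw [hdist'] at hptol
    have hmul : (a * (v - -(R / s))) * (s / R) ≤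
        (a * g / s * v + d.fd (c' (-a)) (c v) * (R / s)) * (s / R) :=
      mul_le_mul_of_nonneg_right hptol (div_pos hs hR).le
    have e1 : (a * (v - -(R / s))) * (s / R) = a * v * s / R + a := by field_simp; ring
    have e2 : (a * g / s * v + d.fd (c' (-a)) (c v) * (R / s)) * (s / R) =
        a * v * g / R + d.fd (c' (-a)) (c v) := by field_simp
    have e3 : -((g - s + R / a) * (a * v / R)) + (a + v) =
        a * v * s / R + a - a * v * g / R := by field_simp; ring
    rw [e3]
    linarith
  · rintro ⟨-, h⟩
    linarith [hinj h]
  · rintro ⟨-, h⟩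
    linarith [hinj h]
  · rintro ⟨-, h⟩
    linarith [hinj h]
  · rintro ⟨-, h⟩
    linarith [hinj h]



/-- Lemma 4.6 of the paper.  Let `X` be a Ptolemy space with
properties (E) and (I), `ω ∈ X`, and let `l, l'` be Ptolemy lines in `X_ω` with a
common point `o`.  Let `c, c' : ℝ → X_ω` be unit-speed parameterizations of `l, l'`
with `c 0 = o = c' 0` and let `b(x) = lim_{t→∞}(d(x,c(t)) − t)`.  If `b(c'(t)) = −t`
for all `t ≥ 0`, then `l = l'`. -/
theorem stmt_6 {X : Type*} (S : MobiusStructure X)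
    (hpt : IsPtolemyStructure S) (hE : PropertyE S) (hI : PropertyI S)
    (ω : X) (d : ExtMetric X) (hd : d ∈ S.M) (hrem : d.rem = some ω)
    (l l' : Set X) (hl : IsPtolemyLine S ω l) (hl' : IsPtolemyLine S ω l')
    (c c' : ℝ → X) (hc : IsUnitSpeed d l c) (hc' : IsUnitSpeed d l' c')
    (h0 : c 0 = c' 0)
    (hb : ∀ t : ℝ, 0 ≤ t →
      Filter.Tendsto (fun s => (d.d (c' t) (c s)).toReal - s)
        Filter.atTop (nhds (-t))) :
    l = l' := by

  have hne : ∀ x, x ≠ ω → d.rem ≠ some x := fun x hx h => hx (Option.some.inj (h.symm.trans hrem))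
  have hglue : ∀ a v : ℝ, 0 ≤ a → 0 ≤ v → d.d (c' (-a)) (c v) = ENNReal.ofReal (a + v) := by
    intro a v ha hv
    rw [← fd_eq_add_of_busemann hpt hI hd hrem hl hl' hc hc' h0 hb ha hv,
      ExtMetric.ofReal_fd (hne _ (ne_of_dist hrem hc'.2 _)) (hne _ (ne_of_dist hrem hc.2 _))]
  let c₂ : ℝ → X := fun t => if 0 ≤ t then c t else c' t
  have hc₂ : ∀ s t : ℝ, d.d (c₂ s) (c₂ t) = ENNReal.ofReal |s - t| := by
    intro s t
    rcases le_or_gt 0 s with hs | hs <;> rcases le_or_gt 0 t with ht | ht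
    · simp only [c₂, if_pos hs, if_pos ht, hc.2]
    · simp only [c₂, if_pos hs, if_neg ht.not_ge]
      have h := hglue (-t) s (by linarith) hs
      rw [neg_neg] at h
      rw [d.symm, h, abs_of_pos (by linarith)]
      ring_nf
    · simp only [c₂, if_neg hs.not_ge, if_pos ht]
      have h := hglue (-s) t (by linarith) ht
      rw [neg_neg] at h
      rw [h, abs_of_neg (by linarith)]
      ring_nf
    · simp only [c₂, if_neg hs.not_ge, if_neg ht.not_ge, hc'.2]
  have hcc₂ : c = c₂ := eq_of_eqOn_ray hI hd hrem hc.2 hc₂ fun t ht => (if_pos ht).symm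
  have hneg : ∀ t, t ≤ 0 → c t = c' t := by
    intro t ht
    rcases ht.eq_or_lt with rfl | ht
    · exact h0
    · rw [hcc₂]
      exact if_neg ht.not_ge
  have hrev : ∀ f : ℝ → X, (∀ s t : ℝ, d.d (f s) (f t) = ENNReal.ofReal |s - t|) →
      ∀ s t : ℝ, d.d (f (-s)) (f (-t)) = ENNReal.ofReal |s - t| := by
    intro f hf s t
    rw [hf, neg_sub_neg, abs_sub_comm]
  have heq : (fun t => c (-t)) = fun t => c' (-t) :=
    eq_of_eqOn_ray hI hd hrem (hrev c hc.2) (hrev c' hc'.2) fun t ht => hneg _ (by linarith)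
  have hcc : c = c' := by
    funext t
    simpa using congrFun heq (-t)
  rw [← hc.1, ← hc'.1, hcc]

end Mobius
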